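/- Let J : 𝒜 → ℰ be a pseudofunctor, T a J-relative pseudomonad, (ν, ε) : ℓ ⊣ r an adjunction in ℰ with ℓ : A → B, r : B → A and ν invertible (a coreflection), and (B, (-)^b, b̂, b̃) a T-pseudoalgebra. If the 2-cell r(ε f)^b : r(ℓ r f)^b ⇒ r f^b is invertible for every f : JX → B, then: (1) A carries a T-pseudoalgebra structure with extension operator f ↦ r (ℓ f)^b, unit 2-cells ã_f := (r b̃_{ℓ f}) ∘ (ν f), and associativity 2-cells â_{g,f} := (r b̂_{ℓg, f}) ∘ (r (ε (ℓ g)^b f)^b); (2) r carries a pseudomorphism structure (with r̄_f := r(ε f)^b) and ℓ the mate colax morphism structure; (3) ν and ε are transformations; hence the adjunction ℓ ⊣ r lifts to an adjunction in PsAlg_c(T), and if ℓ ⊣ r is an adjoint equivalence it lifts to an adjoint equivalence in PsAlg(T). Conversely, if ℓ ⊣ r lifts to an adjunction in PsAlg_c(T), then r(ε f)^b is invertible for every f : JX → B. -/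

import Mathlib

open CategoryTheory Bicategory

universe w₁ v₁ u₁ w₂ v₂ u₂

section RelPsMnd

variable {𝒜 : Type u₁} [Bicategory.{w₁, v₁} 𝒜] {ℰ : Type u₂} [Bicategory.{w₂, v₂} ℰ]

/-- Precomposition with a fixed 1-cell, as a functor between hom-categories. -/
@[simps]
def precompF {a b : ℰ} (c : ℰ) (f : a ⟶ b) : (b ⟶ c) ⥤ (a ⟶ c) where
  obj g := f ≫ g
  map η := f ◁ η

/-- A pseudomonad relative to a pseudofunctor `J : 𝒜 ⥤ ℰ`, given in extension form:
an object assignment, extension operators, units, and invertible coherence 2-cells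
`mul` (μ), `eta` (η), `theta` (θ) subject to associativity and unit laws. -/
structure RelativePseudomonad (J : Pseudofunctor 𝒜 ℰ) where
  obj : 𝒜 → ℰ
  unit : ∀ X : 𝒜, J.obj X ⟶ obj X
  ext : ∀ {X Y : 𝒜}, (J.obj X ⟶ obj Y) ⥤ (obj X ⟶ obj Y)
  mul : ∀ {X Y Z : 𝒜} (f : J.obj X ⟶ obj Y) (g : J.obj Y ⟶ obj Z),
    ext.obj (f ≫ ext.obj g) ≅ ext.obj f ≫ ext.obj g
  eta : ∀ {X Y : 𝒜} (f : J.obj X ⟶ obj Y), f ≅ unit X ≫ ext.obj f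
  theta : ∀ X : 𝒜, ext.obj (unit X) ≅ 𝟙 (obj X)
  mul_natural : ∀ {X Y Z : 𝒜} {f f' : J.obj X ⟶ obj Y} {g g' : J.obj Y ⟶ obj Z}
    (α : f ⟶ f') (β : g ⟶ g'),
    ext.map (α ▷ ext.obj g ≫ f' ◁ ext.map β) ≫ (mul f' g').hom =
      (mul f g).hom ≫ (ext.map α ▷ ext.obj g ≫ ext.obj f' ◁ ext.map β)
  eta_natural : ∀ {X Y : 𝒜} {f f' : J.obj X ⟶ obj Y} (α : f ⟶ f'),
    α ≫ (eta f').hom = (eta f).hom ≫ unit X ◁ ext.map α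
  assoc : ∀ {W X Y Z : 𝒜} (f : J.obj W ⟶ obj X) (g : J.obj X ⟶ obj Y)
    (h : J.obj Y ⟶ obj Z),
    (mul f (g ≫ ext.obj h)).hom ≫ ext.obj f ◁ (mul g h).hom =
      ext.map (f ◁ (mul g h).hom) ≫ ext.map (α_ f (ext.obj g) (ext.obj h)).inv ≫
        (mul (f ≫ ext.obj g) h).hom ≫ (mul f g).hom ▷ ext.obj h ≫
        (α_ (ext.obj f) (ext.obj g) (ext.obj h)).hom
  unit_law : ∀ {X Y : 𝒜} (f : J.obj X ⟶ obj Y),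
    ext.map (eta f).hom ≫ (mul (unit X) f).hom ≫ (theta X).hom ▷ ext.obj f =
      (λ_ (ext.obj f)).inv

namespace RelativePseudomonad

variable {J : Pseudofunctor 𝒜 ℰ} (T : RelativePseudomonad J)

/-- The data of a pseudoalgebra for a relative pseudomonad on a carrier `C`:
extension operators `ext`, associativity 2-cells `ahat` (â) and unit 2-cells `atil` (ã). -/
structure AlgData (C : ℰ) where
  ext : ∀ (X : 𝒜), (J.obj X ⟶ C) ⥤ (T.obj X ⟶ C)
  ahat : ∀ {X Y : 𝒜} (f : J.obj X ⟶ T.obj Y) (g : J.obj Y ⟶ C),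
    (ext X).obj (f ≫ (ext Y).obj g) ≅ T.ext.obj f ≫ (ext Y).obj g
  atil : ∀ {X : 𝒜} (f : J.obj X ⟶ C), f ≅ T.unit X ≫ (ext X).obj f

/-- The pseudoalgebra axioms. -/
structure AlgData.Laws {C : ℰ} (S : T.AlgData C) : Prop where
  ahat_natural : ∀ {X Y : 𝒜} {f f' : J.obj X ⟶ T.obj Y} {g g' : J.obj Y ⟶ C}
    (α : f ⟶ f') (β : g ⟶ g'),
    (S.ext X).map (α ▷ (S.ext Y).obj g ≫ f' ◁ (S.ext Y).map β) ≫ (S.ahat f' g').hom =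
      (S.ahat f g).hom ≫ (T.ext.map α ▷ (S.ext Y).obj g ≫ T.ext.obj f' ◁ (S.ext Y).map β)
  atil_natural : ∀ {X : 𝒜} {f f' : J.obj X ⟶ C} (α : f ⟶ f'),
    α ≫ (S.atil f').hom = (S.atil f).hom ≫ T.unit X ◁ (S.ext X).map α
  assoc : ∀ {W X Y : 𝒜} (f : J.obj W ⟶ T.obj X) (g : J.obj X ⟶ T.obj Y)
    (h : J.obj Y ⟶ C),
    (S.ahat f (g ≫ (S.ext Y).obj h)).hom ≫ T.ext.obj f ◁ (S.ahat g h).hom =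
      (S.ext W).map (f ◁ (S.ahat g h).hom) ≫
        (S.ext W).map (α_ f (T.ext.obj g) ((S.ext Y).obj h)).inv ≫
        (S.ahat (f ≫ T.ext.obj g) h).hom ≫ (T.mul f g).hom ▷ (S.ext Y).obj h ≫
        (α_ (T.ext.obj f) (T.ext.obj g) ((S.ext Y).obj h)).hom
  unit : ∀ {X : 𝒜} (f : J.obj X ⟶ C),
    (S.ext X).map (S.atil f).hom ≫ (S.ahat (T.unit X) f).hom ≫
      (T.theta X).hom ▷ (S.ext X).obj f = (λ_ ((S.ext X).obj f)).inv

/-- A pseudoalgebra: data together with the laws. -/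
structure Algebra (C : ℰ) extends AlgData T C where
  laws : toAlgData.Laws

/-- The data of the free pseudoalgebra on an object of `𝒜`. -/
@[simps]
def freeAlgData (X : 𝒜) : T.AlgData (T.obj X) where
  ext _ := T.ext
  ahat f g := T.mul f g
  atil f := T.eta f

theorem freeAlgData_laws (X : 𝒜) : (T.freeAlgData X).Laws where
  ahat_natural := T.mul_natural
  atil_natural := T.eta_natural
  assoc := T.assoc
  unit := T.unit_law

/-- The free pseudoalgebra on `X`. -/
def freeAlgebra (X : 𝒜) : T.Algebra (T.obj X) := ⟨T.freeAlgData X, T.freeAlgData_laws X⟩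

variable {T}

/-- The data of a lax morphism of pseudoalgebras: a 1-cell between the carriers
together with the comparison 2-cells `lax`. -/
structure LaxData {C C' : ℰ} (S : T.AlgData C) (S' : T.AlgData C') where
  hom : C ⟶ C'
  lax : ∀ (X : 𝒜) (f : J.obj X ⟶ C),
    (S'.ext X).obj (f ≫ hom) ⟶ (S.ext X).obj f ≫ hom

/-- The axioms for a lax morphism of pseudoalgebras. -/
structure LaxData.IsLaxMorphism {C C' : ℰ} {S : T.AlgData C} {S' : T.AlgData C'}
    (m : LaxData S S') : Prop where
  natural : ∀ {X : 𝒜} {f f' : J.obj X ⟶ C} (α : f ⟶ f'),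
    (S'.ext X).map (α ▷ m.hom) ≫ m.lax X f' = m.lax X f ≫ (S.ext X).map α ▷ m.hom
  unit : ∀ {X : 𝒜} (f : J.obj X ⟶ C),
    (S'.atil (f ≫ m.hom)).hom ≫ T.unit X ◁ m.lax X f =
      (S.atil f).hom ▷ m.hom ≫ (α_ (T.unit X) ((S.ext X).obj f) m.hom).hom
  assoc : ∀ {X Y : 𝒜} (f : J.obj X ⟶ T.obj Y) (g : J.obj Y ⟶ C),
    (S'.ahat f (g ≫ m.hom)).hom ≫ T.ext.obj f ◁ m.lax Y g ≫
        (α_ (T.ext.obj f) ((S.ext Y).obj g) m.hom).inv =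
      (S'.ext X).map (f ◁ m.lax Y g) ≫
        (S'.ext X).map (α_ f ((S.ext Y).obj g) m.hom).inv ≫
        m.lax X (f ≫ (S.ext Y).obj g) ≫ (S.ahat f g).hom ▷ m.hom

/-- Pseudomorphisms are lax morphisms whose comparison 2-cells are invertible. -/
def LaxData.IsPseudoMorphism {C C' : ℰ} {S : T.AlgData C} {S' : T.AlgData C'}
    (m : LaxData S S') : Prop :=
  m.IsLaxMorphism ∧ ∀ (X : 𝒜) (f : J.obj X ⟶ C), IsIso (m.lax X f)

/-- The data of a colax morphism of pseudoalgebras. -/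
structure ColaxData {C C' : ℰ} (S : T.AlgData C) (S' : T.AlgData C') where
  hom : C ⟶ C'
  colax : ∀ (X : 𝒜) (f : J.obj X ⟶ C),
    (S.ext X).obj f ≫ hom ⟶ (S'.ext X).obj (f ≫ hom)

/-- The axioms for a colax morphism of pseudoalgebras. -/
structure ColaxData.IsColaxMorphism {C C' : ℰ} {S : T.AlgData C} {S' : T.AlgData C'}
    (m : ColaxData S S') : Prop where
  natural : ∀ {X : 𝒜} {f f' : J.obj X ⟶ C} (α : f ⟶ f'),
    m.colax X f ≫ (S'.ext X).map (α ▷ m.hom) = (S.ext X).map α ▷ m.hom ≫ m.colax X f'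
  unit : ∀ {X : 𝒜} (f : J.obj X ⟶ C),
    (S.atil f).hom ▷ m.hom ≫ (α_ (T.unit X) ((S.ext X).obj f) m.hom).hom ≫
        T.unit X ◁ m.colax X f =
      (S'.atil (f ≫ m.hom)).hom
  assoc : ∀ {X Y : 𝒜} (f : J.obj X ⟶ T.obj Y) (g : J.obj Y ⟶ C),
    (S.ahat f g).hom ▷ m.hom ≫ (α_ (T.ext.obj f) ((S.ext Y).obj g) m.hom).hom ≫
        T.ext.obj f ◁ m.colax Y g =
      m.colax X (f ≫ (S.ext Y).obj g) ≫
        (S'.ext X).map (α_ f ((S.ext Y).obj g) m.hom).hom ≫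
        (S'.ext X).map (f ◁ m.colax Y g) ≫ (S'.ahat f (g ≫ m.hom)).hom

/-- A 2-cell between (the underlying 1-cells of) two lax morphisms is a transformation. -/
def IsTransformation {C C' : ℰ} {S : T.AlgData C} {S' : T.AlgData C'}
    (m m' : LaxData S S') (α : m.hom ⟶ m'.hom) : Prop :=
  ∀ (X : 𝒜) (f : J.obj X ⟶ C),
    (S'.ext X).map (f ◁ α) ≫ m'.lax X f = m.lax X f ≫ (S.ext X).obj f ◁ α

/-- A 2-cell between (the underlying 1-cells of) two colax morphisms is a transformation. -/
def IsColaxTransformation {C C' : ℰ} {S : T.AlgData C} {S' : T.AlgData C'}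
    (m m' : ColaxData S S') (α : m.hom ⟶ m'.hom) : Prop :=
  ∀ (X : 𝒜) (f : J.obj X ⟶ C),
    (S.ext X).obj f ◁ α ≫ m'.colax X f = m.colax X f ≫ (S'.ext X).map (f ◁ α)

/-- The identity lax morphism data, with the canonical comparison 2-cells
`(1 ∘ f)^a ≅ f^a ≅ 1 ∘ f^a`. -/
@[simps]
def idLaxData {C : ℰ} (S : T.AlgData C) : LaxData S S where
  hom := 𝟙 C
  lax X f := (S.ext X).map (ρ_ f).hom ≫ (ρ_ ((S.ext X).obj f)).inv

/-- The composite of two lax morphism data. -/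
@[simps]
def compLaxData {C C' C'' : ℰ} {S : T.AlgData C} {S' : T.AlgData C'} {S'' : T.AlgData C''}
    (m : LaxData S S') (m' : LaxData S' S'') : LaxData S S'' where
  hom := m.hom ≫ m'.hom
  lax X f :=
    (S''.ext X).map (α_ f m.hom m'.hom).inv ≫ m'.lax X (f ≫ m.hom) ≫
      m.lax X f ▷ m'.hom ≫ (α_ ((S.ext X).obj f) m.hom m'.hom).hom

/-- The identity colax morphism data. -/
@[simps]
def idColaxData {C : ℰ} (S : T.AlgData C) : ColaxData S S where
  hom := 𝟙 C
  colax X f := (ρ_ ((S.ext X).obj f)).hom ≫ (S.ext X).map (ρ_ f).inv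

/-- The composite of two colax morphism data. -/
@[simps]
def compColaxData {C C' C'' : ℰ} {S : T.AlgData C} {S' : T.AlgData C'} {S'' : T.AlgData C''}
    (m : ColaxData S S') (m' : ColaxData S' S'') : ColaxData S S'' where
  hom := m.hom ≫ m'.hom
  colax X f :=
    (α_ ((S.ext X).obj f) m.hom m'.hom).inv ≫ m.colax X f ▷ m'.hom ≫
      m'.colax X (f ≫ m.hom) ≫ (S''.ext X).map (α_ f m.hom m'.hom).hom

/-- Morphisms of pseudoalgebras satisfying a property `P` (e.g. lax morphisms,
pseudomorphisms), which form a category under transformations. -/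
def Mor {C C' : ℰ} (S : T.AlgData C) (S' : T.AlgData C') (P : LaxData S S' → Prop) :=
  { m : LaxData S S' // P m }

instance morCategory {C C' : ℰ} (S : T.AlgData C) (S' : T.AlgData C')
    (P : LaxData S S' → Prop) : Category (Mor S S' P) where
  Hom m m' := { α : m.val.hom ⟶ m'.val.hom // IsTransformation m.val m'.val α }
  id m := ⟨𝟙 m.val.hom, by intro X f; simp⟩
  comp {m m' m''} α β := ⟨α.val ≫ β.val, by
    intro X f
    have hα := α.property X f
    have hβ := β.property X f
    simp only [Bicategory.whiskerLeft_comp, Functor.map_comp, Category.assoc]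
    rw [hβ, ← Category.assoc, hα, Category.assoc]⟩
  id_comp := by intros; apply Subtype.ext; simp
  comp_id := by intros; apply Subtype.ext; simp
  assoc := by intros; apply Subtype.ext; simp

/-- The forgetful functor from a category of morphisms of pseudoalgebras and
transformations to the corresponding hom-category of `ℰ`. -/
@[simps]
def morForget {C C' : ℰ} (S : T.AlgData C) (S' : T.AlgData C') (P : LaxData S S' → Prop) :
    Mor S S' P ⥤ (C ⟶ C') where
  obj m := m.val.hom
  map α := α.val

/-- A pseudoalgebra is lax-idempotent when its unit 2-cells `atil` exhibit the unit of
an adjunction between extension and precomposition with the unit of the pseudomonad. -/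
def IsLaxIdempotent {C : ℰ} (S : T.AlgData C) : Prop :=
  ∀ X : 𝒜, ∃ adj : S.ext X ⊣ precompF C (T.unit X),
    ∀ f : J.obj X ⟶ C, adj.unit.app f = (S.atil f).hom

section Mates

variable {C C' : ℰ} {S : T.AlgData C} {S' : T.AlgData C'} {l : C ⟶ C'} {r : C' ⟶ C}

/-- The 2-cell `f ⇒ rℓf` obtained by whiskering the unit of an adjunction. -/
def nuW (adj : Bicategory.Adjunction l r) {a : ℰ} (f : a ⟶ C) : f ⟶ (f ≫ l) ≫ r :=
  (ρ_ f).inv ≫ f ◁ adj.unit ≫ (α_ f l r).inv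

/-- The 2-cell `ℓrg ⇒ g` obtained by whiskering the counit of an adjunction. -/
def epsW (adj : Bicategory.Adjunction l r) {a : ℰ} (g : a ⟶ C') : (g ≫ r) ≫ l ⟶ g :=
  (α_ g r l).hom ≫ g ◁ adj.counit ≫ (ρ_ g).hom

/-- The colax morphism structure on a left adjoint `ℓ` obtained as the mate of a lax
morphism structure on its right adjoint `r`. -/
def colaxMate (adj : Bicategory.Adjunction l r)
    (rl : ∀ (X : 𝒜) (g : J.obj X ⟶ C'), (S.ext X).obj (g ≫ r) ⟶ (S'.ext X).obj g ≫ r) :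
    ∀ (X : 𝒜) (f : J.obj X ⟶ C), (S.ext X).obj f ≫ l ⟶ (S'.ext X).obj (f ≫ l) :=
  fun X f =>
    (S.ext X).map (nuW adj f) ▷ l ≫ rl X (f ≫ l) ▷ l ≫
      (α_ ((S'.ext X).obj (f ≫ l)) r l).hom ≫ (S'.ext X).obj (f ≫ l) ◁ adj.counit ≫
      (ρ_ ((S'.ext X).obj (f ≫ l))).hom

/-- The lax morphism structure on a right adjoint `r` obtained as the mate of a colax
morphism structure on its left adjoint `ℓ`. -/
def laxMate (adj : Bicategory.Adjunction l r)
    (lc : ∀ (X : 𝒜) (f : J.obj X ⟶ C), (S.ext X).obj f ≫ l ⟶ (S'.ext X).obj (f ≫ l)) :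
    ∀ (X : 𝒜) (g : J.obj X ⟶ C'), (S.ext X).obj (g ≫ r) ⟶ (S'.ext X).obj g ≫ r :=
  fun X g =>
    (ρ_ ((S.ext X).obj (g ≫ r))).inv ≫ (S.ext X).obj (g ≫ r) ◁ adj.unit ≫
      (α_ ((S.ext X).obj (g ≫ r)) l r).inv ≫ lc X (g ≫ r) ▷ r ≫
      (S'.ext X).map (epsW adj g) ▷ r

end Mates

end RelativePseudomonad

end RelPsMnd

namespace RelativePseudomonad

variable {𝒜 : Type u₁} [Bicategory.{w₁, v₁} 𝒜] {ℰ : Type u₂} [Bicategory.{w₂, v₂} ℰ]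
variable {J : Pseudofunctor 𝒜 ℰ} {T : RelativePseudomonad J}

variable {CA CB : ℰ} {ℓ : CA ⟶ CB} {r : CB ⟶ CA}

/-- The transport 2-cell `r (ε f)^b : r (ℓ r f)^b ⇒ r f^b`. -/
def rEps (adj : Bicategory.Adjunction ℓ r) (SB : T.AlgData CB)
    (X : 𝒜) (f : J.obj X ⟶ CB) :
    (SB.ext X).obj ((f ≫ r) ≫ ℓ) ≫ r ⟶ (SB.ext X).obj f ≫ r :=
  (SB.ext X).map (epsW adj f) ▷ r

/-- The pseudoalgebra structure transported along a coreflective adjunction `ℓ ⊣ r`: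
the extension operator is `f ↦ r (ℓ f)^b`, the unit 2-cells are `(r b̃_{ℓf}) ∘ (ν f)` and
the associativity 2-cells are `(r b̂_{ℓg,f}) ∘ (r (ε (ℓ g)^b f)^b)`. -/
noncomputable def transportData (adj : Bicategory.Adjunction ℓ r) (SB : T.AlgData CB)
    (hν : IsIso adj.unit)
    (hinv : ∀ (X : 𝒜) (f : J.obj X ⟶ CB), IsIso (rEps adj SB X f)) :
    T.AlgData CA where
  ext X :=
    { obj := fun f => (SB.ext X).obj (f ≫ ℓ) ≫ r
      map := fun κ => (SB.ext X).map (κ ▷ ℓ) ▷ r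
      map_id := by intros; simp
      map_comp := by intros; simp }
  ahat {X Y} f g := by
    haveI : IsIso ((SB.ext X).map
        (epsW adj (f ≫ (SB.ext Y).obj (g ≫ ℓ))) ▷ r) :=
      hinv X (f ≫ (SB.ext Y).obj (g ≫ ℓ))
    haveI : IsIso ((SB.ext X).map
        ((α_ f ((SB.ext Y).obj (g ≫ ℓ)) r).inv ▷ ℓ ≫
          epsW adj (f ≫ (SB.ext Y).obj (g ≫ ℓ))) ▷ r) := by
      rw [Functor.map_comp, Bicategory.comp_whiskerRight]
      infer_instance
    exact asIso
      ((SB.ext X).map ((α_ f ((SB.ext Y).obj (g ≫ ℓ)) r).inv ▷ ℓ ≫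
          epsW adj (f ≫ (SB.ext Y).obj (g ≫ ℓ))) ▷ r ≫
        (SB.ahat f (g ≫ ℓ)).hom ▷ r ≫
        (α_ (T.ext.obj f) ((SB.ext Y).obj (g ≫ ℓ)) r).hom)
  atil {X} f := by
    haveI := hν
    haveI : IsIso (nuW adj f) := by unfold nuW; infer_instance
    exact asIso (nuW adj f ≫ (SB.atil (f ≫ ℓ)).hom ▷ r ≫
      (α_ (T.unit X) ((SB.ext X).obj (f ≫ ℓ)) r).hom)

section Transport

section Whiskering

variable {a a' : ℰ}

theorem epsW_natural (adj : Bicategory.Adjunction ℓ r) {g g' : a ⟶ CB} (κ : g ⟶ g') :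
    (κ ▷ r) ▷ ℓ ≫ epsW adj g' = epsW adj g ≫ κ := by
  simp only [epsW, Category.assoc, associator_naturality_left_assoc,
    ← whisker_exchange_assoc, rightUnitor_naturality]

theorem nuW_natural (adj : Bicategory.Adjunction ℓ r) {f f' : a ⟶ CA} (κ : f ⟶ f') :
    κ ≫ nuW adj f' = nuW adj f ≫ (κ ▷ ℓ) ▷ r := by
  simp only [nuW, Category.assoc, ← associator_inv_naturality_left, whisker_exchange_assoc,
    rightUnitor_inv_naturality_assoc]

theorem epsW_comp (adj : Bicategory.Adjunction ℓ r) (f : a ⟶ a') (g : a' ⟶ CB) :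
    (α_ f g r).inv ▷ ℓ ≫ epsW adj (f ≫ g) = (α_ f (g ≫ r) ℓ).hom ≫ f ◁ epsW adj g := by
  simp only [epsW]
  bicategory

theorem nuW_whiskerRight_epsW (adj : Bicategory.Adjunction ℓ r) (f : a ⟶ CA) :
    nuW adj f ▷ ℓ ≫ epsW adj (f ≫ ℓ) = 𝟙 (f ≫ ℓ) := by
  have h := congrArg (fun x => f ◁ x) adj.left_triangle
  simp only [leftZigzag] at h
  calc _ = 𝟙 _ ⊗≫ f ◁ (adj.unit ▷ ℓ ⊗≫ ℓ ◁ adj.counit) ⊗≫ 𝟙 _ := by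
        simp only [epsW, nuW]; bicategory
    _ = 𝟙 _ := by rw [h]; bicategory

theorem nuW_epsW_whiskerRight (adj : Bicategory.Adjunction ℓ r) (g : a ⟶ CB) :
    nuW adj (g ≫ r) ≫ epsW adj g ▷ r = 𝟙 (g ≫ r) := by
  have h := congrArg (fun x => g ◁ x) adj.right_triangle
  simp only [rightZigzag] at h
  calc _ = 𝟙 _ ⊗≫ g ◁ (r ◁ adj.unit ⊗≫ adj.counit ▷ r) ⊗≫ 𝟙 _ := by
        simp only [epsW, nuW]; bicategory
    _ = 𝟙 _ := by rw [h]; bicategory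

end Whiskering

theorem colaxMate_rEps (adj : Bicategory.Adjunction ℓ r) (SB : T.AlgData CB)
    (hν : IsIso adj.unit)
    (hinv : ∀ (X : 𝒜) (f : J.obj X ⟶ CB), IsIso (rEps adj SB X f))
    (X : 𝒜) (f : J.obj X ⟶ CA) :
    colaxMate (S := transportData adj SB hν hinv) adj (fun X f => rEps adj SB X f) X f =
      epsW adj ((SB.ext X).obj (f ≫ ℓ)) := by
  change ((SB.ext X).map (nuW adj f ▷ ℓ) ▷ r) ▷ ℓ ≫
    ((SB.ext X).map (epsW adj (f ≫ ℓ)) ▷ r) ▷ ℓ ≫ epsW adj ((SB.ext X).obj (f ≫ ℓ)) = _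
  rw [← comp_whiskerRight_assoc, ← comp_whiskerRight, ← Functor.map_comp,
    nuW_whiskerRight_epsW]
  simp

section Data

variable (adj : Bicategory.Adjunction ℓ r) (SB : T.AlgData CB)
  (hν : IsIso adj.unit)
  (hinv : ∀ (X : 𝒜) (f : J.obj X ⟶ CB), IsIso (rEps adj SB X f))

theorem transportData_ext_obj (X : 𝒜) (f : J.obj X ⟶ CA) :
    ((transportData adj SB hν hinv).ext X).obj f = (SB.ext X).obj (f ≫ ℓ) ≫ r := rfl

theorem transportData_ext_map (X : 𝒜) {f f' : J.obj X ⟶ CA} (κ : f ⟶ f') :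
    ((transportData adj SB hν hinv).ext X).map κ = (SB.ext X).map (κ ▷ ℓ) ▷ r := rfl

theorem transportData_ahat_hom {X Y : 𝒜} (f : J.obj X ⟶ T.obj Y) (g : J.obj Y ⟶ CA) :
    ((transportData adj SB hν hinv).ahat f g).hom =
      (SB.ext X).map ((α_ f ((SB.ext Y).obj (g ≫ ℓ)) r).inv ▷ ℓ ≫
          epsW adj (f ≫ (SB.ext Y).obj (g ≫ ℓ))) ▷ r ≫
        (SB.ahat f (g ≫ ℓ)).hom ▷ r ≫
        (α_ (T.ext.obj f) ((SB.ext Y).obj (g ≫ ℓ)) r).hom := rfl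

theorem transportData_atil_hom {X : 𝒜} (f : J.obj X ⟶ CA) :
    ((transportData adj SB hν hinv).atil f).hom =
      nuW adj f ≫ (SB.atil (f ≫ ℓ)).hom ▷ r ≫
      (α_ (T.unit X) ((SB.ext X).obj (f ≫ ℓ)) r).hom := rfl

end Data

variable {adj : Bicategory.Adjunction ℓ r} {SB : T.AlgData CB}
  {hν : IsIso adj.unit}
  {hinv : ∀ (X : 𝒜) (f : J.obj X ⟶ CB), IsIso (rEps adj SB X f)}

theorem AlgData.Laws.map_whiskerLeft_ahat {C : ℰ} {S : T.AlgData C} (hS : S.Laws) {X Y : 𝒜}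
    (f : J.obj X ⟶ T.obj Y) {g g' : J.obj Y ⟶ C} (β : g ⟶ g') :
    (S.ext X).map (f ◁ (S.ext Y).map β) ≫ (S.ahat f g').hom =
      (S.ahat f g).hom ≫ T.ext.obj f ◁ (S.ext Y).map β := by
  simpa using hS.ahat_natural (𝟙 f) β

theorem transportData_ahat_natural (hB : SB.Laws) {X Y : 𝒜} {f f' : J.obj X ⟶ T.obj Y}
    {g g' : J.obj Y ⟶ CA} (α : f ⟶ f') (β : g ⟶ g') :
    ((transportData adj SB hν hinv).ext X).map
        (α ▷ ((transportData adj SB hν hinv).ext Y).obj g ≫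
          f' ◁ ((transportData adj SB hν hinv).ext Y).map β) ≫
        ((transportData adj SB hν hinv).ahat f' g').hom =
      ((transportData adj SB hν hinv).ahat f g).hom ≫
        (T.ext.map α ▷ ((transportData adj SB hν hinv).ext Y).obj g ≫
          T.ext.obj f' ◁ ((transportData adj SB hν hinv).ext Y).map β) := by
  simp only [transportData_ext_obj, transportData_ext_map, transportData_ahat_hom]
  have key : (α ▷ ((SB.ext Y).obj (g ≫ ℓ) ≫ r) ≫ f' ◁ ((SB.ext Y).map (β ▷ ℓ) ▷ r)) ▷ ℓ ≫
      (α_ f' ((SB.ext Y).obj (g' ≫ ℓ)) r).inv ▷ ℓ ≫ epsW adj (f' ≫ (SB.ext Y).obj (g' ≫ ℓ)) =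
      (α_ f ((SB.ext Y).obj (g ≫ ℓ)) r).inv ▷ ℓ ≫ epsW adj (f ≫ (SB.ext Y).obj (g ≫ ℓ)) ≫
        (α ▷ (SB.ext Y).obj (g ≫ ℓ) ≫ f' ◁ (SB.ext Y).map (β ▷ ℓ)) := by
    rw [← epsW_natural, ← comp_whiskerRight_assoc, ← comp_whiskerRight_assoc]
    congr 2
    simp
  have h := congrArg (fun x => (SB.ext X).map x ▷ r) key
  simp only [Functor.map_comp, comp_whiskerRight, Category.assoc] at h ⊢
  rw [reassoc_of% h]
  have h2 := congrArg (· ▷ r) (hB.ahat_natural α (β ▷ ℓ))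
  simp only [Functor.map_comp, comp_whiskerRight, Category.assoc] at h2
  rw [reassoc_of% h2]
  simp

theorem transportData_atil_natural (hB : SB.Laws) {X : 𝒜} {f f' : J.obj X ⟶ CA}
    (α : f ⟶ f') :
    α ≫ ((transportData adj SB hν hinv).atil f').hom =
      ((transportData adj SB hν hinv).atil f).hom ≫
        T.unit X ◁ ((transportData adj SB hν hinv).ext X).map α := by
  simp only [transportData_ext_obj, transportData_ext_map, transportData_atil_hom]
  have h := congrArg (· ▷ r) (hB.atil_natural (α ▷ ℓ))
  simp only [comp_whiskerRight] at h
  rw [← Category.assoc, nuW_natural, Category.assoc, reassoc_of% h]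
  simp

theorem transportData_assoc (hB : SB.Laws) {W X Y : 𝒜} (f : J.obj W ⟶ T.obj X)
    (g : J.obj X ⟶ T.obj Y) (h : J.obj Y ⟶ CA) :
    ((transportData adj SB hν hinv).ahat f
        (g ≫ ((transportData adj SB hν hinv).ext Y).obj h)).hom ≫
        T.ext.obj f ◁ ((transportData adj SB hν hinv).ahat g h).hom =
      ((transportData adj SB hν hinv).ext W).map
          (f ◁ ((transportData adj SB hν hinv).ahat g h).hom) ≫
        ((transportData adj SB hν hinv).ext W).map
          (α_ f (T.ext.obj g) (((transportData adj SB hν hinv).ext Y).obj h)).inv ≫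
        ((transportData adj SB hν hinv).ahat (f ≫ T.ext.obj g) h).hom ≫
        (T.mul f g).hom ▷ ((transportData adj SB hν hinv).ext Y).obj h ≫
        (α_ (T.ext.obj f) (T.ext.obj g) (((transportData adj SB hν hinv).ext Y).obj h)).hom := by
  simp only [transportData_ext_obj, transportData_ext_map, transportData_ahat_hom]
  have key : ∀ {K : T.obj X ⟶ CB} (c : K ⟶ T.ext.obj g ≫ (SB.ext Y).obj (h ≫ ℓ)),
      (f ◁ (c ▷ r ≫ (α_ _ _ _).hom)) ▷ ℓ ≫ (α_ f (T.ext.obj g) _).inv ▷ ℓ ≫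
      (α_ (f ≫ T.ext.obj g) ((SB.ext Y).obj (h ≫ ℓ)) r).inv ▷ ℓ ≫ epsW adj _ =
      (α_ f K r).inv ▷ ℓ ≫ epsW adj _ ≫ f ◁ c ≫ (α_ _ _ _).inv := by
    intro K c
    rw [← epsW_natural, ← comp_whiskerRight_assoc, ← comp_whiskerRight_assoc,
      ← comp_whiskerRight_assoc]
    congr 2
    simp
  have hL := (SB.ahat f ((g ≫ (SB.ext Y).obj (h ≫ ℓ) ≫ r) ≫ ℓ)).hom ≫= congrArg
    (fun x => T.ext.obj f ◁ ((SB.ext X).map x ≫ (SB.ahat g (h ≫ ℓ)).hom))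
    (rfl : (α_ g ((SB.ext Y).obj (h ≫ ℓ)) r).inv ▷ ℓ ≫
      epsW adj (g ≫ (SB.ext Y).obj (h ≫ ℓ)) = _)
  conv_rhs at hL =>
    rw [whiskerLeft_comp, ← reassoc_of% hB.map_whiskerLeft_ahat, hB.assoc,
      ← Functor.map_comp_assoc, ← Functor.map_comp_assoc]
  have hL' := congrArg (· ▷ r) hL
  have hk := congrArg (fun x => (SB.ext W).map x ▷ r) (key ((SB.ext X).map
    ((α_ g ((SB.ext Y).obj (h ≫ ℓ)) r).inv ▷ ℓ ≫
      epsW adj (g ≫ (SB.ext Y).obj (h ≫ ℓ))) ≫ (SB.ahat g (h ≫ ℓ)).hom))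
  simp only [Functor.map_comp, comp_whiskerRight, whiskerLeft_comp, Category.assoc] at hL' hk ⊢
  rw [reassoc_of% hk]
  simp only [← associator_naturality_middle_assoc]
  rw [reassoc_of% hL']
  simp

theorem transportData_unit (hB : SB.Laws) {X : 𝒜} (f : J.obj X ⟶ CA) :
    ((transportData adj SB hν hinv).ext X).map ((transportData adj SB hν hinv).atil f).hom ≫
        ((transportData adj SB hν hinv).ahat (T.unit X) f).hom ≫
        (T.theta X).hom ▷ ((transportData adj SB hν hinv).ext X).obj f =
      (λ_ (((transportData adj SB hν hinv).ext X).obj f)).inv := by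
  simp only [transportData_ext_obj, transportData_ext_map, transportData_ahat_hom,
    transportData_atil_hom]
  have key : (nuW adj f ≫ (SB.atil (f ≫ ℓ)).hom ▷ r ≫
      (α_ (T.unit X) ((SB.ext X).obj (f ≫ ℓ)) r).hom) ▷ ℓ ≫
      (α_ (T.unit X) ((SB.ext X).obj (f ≫ ℓ)) r).inv ▷ ℓ ≫
        epsW adj (T.unit X ≫ (SB.ext X).obj (f ≫ ℓ)) = (SB.atil (f ≫ ℓ)).hom := by
    rw [← comp_whiskerRight_assoc]
    simp only [Category.assoc, Iso.hom_inv_id, Category.comp_id, comp_whiskerRight]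
    rw [epsW_natural, ← Category.assoc, nuW_whiskerRight_epsW, Category.id_comp]
  have hk := congrArg (fun x => (SB.ext X).map x ▷ r) key
  have hu := congrArg (· ▷ r) (hB.unit (f ≫ ℓ))
  simp only [Functor.map_comp, comp_whiskerRight, Category.assoc] at hk hu ⊢
  rw [reassoc_of% hk]
  rw [← associator_naturality_left, reassoc_of% hu]
  simp

theorem transportData_laws (hB : SB.Laws) : (transportData adj SB hν hinv).Laws where
  ahat_natural := transportData_ahat_natural hB
  atil_natural := transportData_atil_natural hB
  assoc := transportData_assoc hB
  unit := transportData_unit hB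

theorem transport_right_isPseudoMorphism (hB : SB.Laws) :
    (⟨r, fun X f => rEps adj SB X f⟩ :
      LaxData SB (transportData adj SB hν hinv)).IsPseudoMorphism := by
  refine ⟨⟨?_, ?_, ?_⟩, hinv⟩
  · intro X f f' α
    change (SB.ext X).map ((α ▷ r) ▷ ℓ) ▷ r ≫ (SB.ext X).map (epsW adj f') ▷ r =
      (SB.ext X).map (epsW adj f) ▷ r ≫ (SB.ext X).map α ▷ r
    rw [← comp_whiskerRight, ← Functor.map_comp, epsW_natural, Functor.map_comp,
      comp_whiskerRight]
  · intro X f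
    dsimp only [rEps, transportData_atil_hom, transportData_ext_obj]
    have h := congrArg (· ▷ r) (hB.atil_natural (epsW adj f))
    simp only [comp_whiskerRight] at h
    simp only [Category.assoc]
    rw [← associator_naturality_middle, ← reassoc_of% h, ← Category.assoc (nuW _ _),
      nuW_epsW_whiskerRight, Category.id_comp]
  · intro X Y f g
    dsimp only [rEps, transportData_ahat_hom, transportData_ext_obj, transportData_ext_map]
    have key : (f ◁ (SB.ext Y).map (epsW adj g) ▷ r) ▷ ℓ ≫
        (α_ f ((SB.ext Y).obj g) r).inv ▷ ℓ ≫ epsW adj (f ≫ (SB.ext Y).obj g) =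
        (α_ f ((SB.ext Y).obj ((g ≫ r) ≫ ℓ)) r).inv ▷ ℓ ≫ epsW adj _ ≫
          f ◁ (SB.ext Y).map (epsW adj g) := by
      rw [← epsW_natural, ← comp_whiskerRight_assoc, ← comp_whiskerRight_assoc]
      congr 2
      simp
    have hk := congrArg (fun x => (SB.ext X).map x ▷ r) key
    have ha := congrArg (· ▷ r) (hB.map_whiskerLeft_ahat f (epsW adj g))
    simp only [Functor.map_comp, comp_whiskerRight, Category.assoc] at hk ha ⊢
    rw [reassoc_of% hk, ha]
    simp

theorem colaxData_colaxMate_rEps :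
    (⟨ℓ, colaxMate adj (fun X f => rEps adj SB X f)⟩ :
      ColaxData (transportData adj SB hν hinv) SB) =
      ⟨ℓ, fun X f => epsW adj ((SB.ext X).obj (f ≫ ℓ))⟩ :=
  congrArg (fun c => (⟨ℓ, c⟩ : ColaxData (transportData adj SB hν hinv) SB))
    (funext fun X => funext fun f => colaxMate_rEps adj SB hν hinv X f)

theorem transport_left_isColaxMorphism :
    (⟨ℓ, colaxMate adj (fun X f => rEps adj SB X f)⟩ :
      ColaxData (transportData adj SB hν hinv) SB).IsColaxMorphism := by
  rw [colaxData_colaxMate_rEps]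
  refine ⟨?_, ?_, ?_⟩
  · intro X f f' α
    exact (epsW_natural adj _).symm
  · intro X f
    change (nuW adj f ≫ (SB.atil (f ≫ ℓ)).hom ▷ r ≫
      (α_ (T.unit X) ((SB.ext X).obj (f ≫ ℓ)) r).hom) ▷ ℓ ≫
      (α_ (T.unit X) ((SB.ext X).obj (f ≫ ℓ) ≫ r) ℓ).hom ≫
      T.unit X ◁ epsW adj ((SB.ext X).obj (f ≫ ℓ)) = (SB.atil (f ≫ ℓ)).hom
    rw [← epsW_comp, ← comp_whiskerRight_assoc]
    simp only [Category.assoc, Iso.hom_inv_id, Category.comp_id, comp_whiskerRight]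
    rw [epsW_natural, ← Category.assoc, nuW_whiskerRight_epsW, Category.id_comp]
  · intro X Y f g
    change ((SB.ext X).map ((α_ f ((SB.ext Y).obj (g ≫ ℓ)) r).inv ▷ ℓ ≫
          epsW adj (f ≫ (SB.ext Y).obj (g ≫ ℓ))) ▷ r ≫
        (SB.ahat f (g ≫ ℓ)).hom ▷ r ≫
        (α_ (T.ext.obj f) ((SB.ext Y).obj (g ≫ ℓ)) r).hom) ▷ ℓ ≫
        (α_ (T.ext.obj f) ((SB.ext Y).obj (g ≫ ℓ) ≫ r) ℓ).hom ≫
        T.ext.obj f ◁ epsW adj ((SB.ext Y).obj (g ≫ ℓ)) =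
      epsW adj ((SB.ext X).obj ((f ≫ (SB.ext Y).obj (g ≫ ℓ) ≫ r) ≫ ℓ)) ≫
        (SB.ext X).map (α_ f ((SB.ext Y).obj (g ≫ ℓ) ≫ r) ℓ).hom ≫
        (SB.ext X).map (f ◁ epsW adj ((SB.ext Y).obj (g ≫ ℓ))) ≫ (SB.ahat f (g ≫ ℓ)).hom
    rw [← epsW_comp, ← comp_whiskerRight_assoc, ← Functor.map_comp_assoc, ← epsW_comp]
    simp only [Category.assoc, Iso.hom_inv_id, Category.comp_id]
    rw [← comp_whiskerRight, epsW_natural]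

theorem nuW_map_rEps (X : 𝒜) (f : J.obj X ⟶ CA) :
    (SB.ext X).map (nuW adj f ▷ ℓ) ▷ r ≫ rEps adj SB X (f ≫ ℓ) = 𝟙 _ := by
  rw [rEps, ← comp_whiskerRight, ← Functor.map_comp, nuW_whiskerRight_epsW]
  simp

/-- The inverse of an invertible colax morphism structure is a pseudomorphism structure. -/
theorem ColaxData.IsColaxMorphism.isPseudoMorphism_inv {C C' : ℰ} {S : T.AlgData C}
    {S' : T.AlgData C'} {h : C ⟶ C'}
    {c : ∀ (X : 𝒜) (f : J.obj X ⟶ C), (S.ext X).obj f ≫ h ⟶ (S'.ext X).obj (f ≫ h)}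
    (hm : (⟨h, c⟩ : ColaxData S S').IsColaxMorphism)
    (hc : ∀ (X : 𝒜) (f : J.obj X ⟶ C), IsIso (c X f)) :
    (⟨h, fun X f => inv (c X f)⟩ : LaxData S S').IsPseudoMorphism := by
  refine ⟨⟨?_, ?_, ?_⟩, fun X f => inferInstance⟩
  · intro X f f' α
    have := hm.natural α
    dsimp only at this ⊢
    rw [IsIso.comp_inv_eq, Category.assoc, ← this, IsIso.inv_hom_id_assoc]
  · intro X f
    have := hm.unit f
    dsimp only at this ⊢
    rw [← this]
    simp
  · intro X Y f g
    have := hm.assoc f g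
    dsimp only at this ⊢
    rw [← cancel_epi ((S'.ext X).map (f ◁ c Y g)),
      ← cancel_epi ((S'.ext X).map (α_ f ((S.ext Y).obj g) h).hom),
      ← cancel_epi (c X (f ≫ (S.ext Y).obj g)), ← reassoc_of% this,
      ← Functor.map_comp_assoc, ← Functor.map_comp_assoc, ← Functor.map_comp_assoc]
    simp

theorem transport_unit_isColaxTransformation :
    IsColaxTransformation (idColaxData (transportData adj SB hν hinv))
      (compColaxData
        (⟨ℓ, colaxMate adj (fun X f => rEps adj SB X f)⟩ :
          ColaxData (transportData adj SB hν hinv) SB)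
        (⟨r, fun X f => @inv _ _ _ _ (rEps adj SB X f) (hinv X f)⟩ :
          ColaxData SB (transportData adj SB hν hinv)))
      adj.unit := by
  intro X f
  have := hinv X (f ≫ ℓ)
  have key : ((SB.ext X).obj (f ≫ ℓ) ≫ r) ◁ adj.unit ≫
      (α_ ((SB.ext X).obj (f ≫ ℓ) ≫ r) ℓ r).inv ≫
        epsW adj ((SB.ext X).obj (f ≫ ℓ)) ▷ r ≫ inv (rEps adj SB X (f ≫ ℓ)) ≫
        (SB.ext X).map ((α_ f ℓ r).hom ▷ ℓ) ▷ r =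
      ((ρ_ ((SB.ext X).obj (f ≫ ℓ) ≫ r)).hom ≫ (SB.ext X).map ((ρ_ f).inv ▷ ℓ) ▷ r) ≫
        (SB.ext X).map ((f ◁ adj.unit) ▷ ℓ) ▷ r := by
    have h1 : inv (rEps adj SB X (f ≫ ℓ)) = (SB.ext X).map (nuW adj f ▷ ℓ) ▷ r :=
      (IsIso.eq_inv_of_inv_hom_id (nuW_map_rEps X f)).symm
    have h2 := nuW_epsW_whiskerRight adj ((SB.ext X).obj (f ≫ ℓ))
    simp only [nuW, Category.assoc, Iso.inv_comp_eq, Category.comp_id] at h2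
    rw [h1, reassoc_of% h2, ← comp_whiskerRight, ← Functor.map_comp, ← comp_whiskerRight]
    simp only [nuW, Category.assoc, Iso.inv_hom_id, Category.comp_id, comp_whiskerRight,
      Functor.map_comp]
  refine Eq.trans ?_ key
  exact congrArg (fun t : ((SB.ext X).obj (f ≫ ℓ) ≫ r) ≫ ℓ ⟶ (SB.ext X).obj (f ≫ ℓ) =>
    ((SB.ext X).obj (f ≫ ℓ) ≫ r) ◁ adj.unit ≫
      (α_ ((SB.ext X).obj (f ≫ ℓ) ≫ r) ℓ r).inv ≫
        t ▷ r ≫ inv (rEps adj SB X (f ≫ ℓ)) ≫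
        (SB.ext X).map ((α_ f ℓ r).hom ▷ ℓ) ▷ r) (colaxMate_rEps adj SB hν hinv X f)

theorem rEps_whiskerRight_epsW (X : 𝒜) (f : J.obj X ⟶ CB) :
    rEps adj SB X f ▷ ℓ ≫ epsW adj ((SB.ext X).obj f) =
      epsW adj ((SB.ext X).obj ((f ≫ r) ≫ ℓ)) ≫ (SB.ext X).map (epsW adj f) :=
  epsW_natural adj _

theorem transport_counit_isColaxTransformation :
    IsColaxTransformation
      (compColaxData
        (⟨r, fun X f => @inv _ _ _ _ (rEps adj SB X f) (hinv X f)⟩ :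
          ColaxData SB (transportData adj SB hν hinv))
        (⟨ℓ, colaxMate adj (fun X f => rEps adj SB X f)⟩ :
          ColaxData (transportData adj SB hν hinv) SB))
      (idColaxData SB) adj.counit := by
  intro X f
  have := hinv X f
  have key : (SB.ext X).obj f ◁ adj.counit ≫
        (ρ_ ((SB.ext X).obj f)).hom ≫ (SB.ext X).map (ρ_ f).inv =
      ((α_ ((SB.ext X).obj f) r ℓ).inv ≫ inv (rEps adj SB X f) ▷ ℓ ≫
        epsW adj ((SB.ext X).obj ((f ≫ r) ≫ ℓ)) ≫ (SB.ext X).map (α_ f r ℓ).hom) ≫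
        (SB.ext X).map (f ◁ adj.counit) := by
    have h1 := rEps_whiskerRight_epsW (adj := adj) (SB := SB) X f
    rw [← cancel_epi (α_ ((SB.ext X).obj f) r ℓ).hom, ← cancel_epi (rEps adj SB X f ▷ ℓ),
      ← cancel_mono ((SB.ext X).map (ρ_ f).hom)]
    simp only [epsW, Functor.map_comp] at h1 ⊢
    simpa [← Functor.map_comp] using h1
  refine key.trans ?_
  exact congrArg (fun t : ((SB.ext X).obj ((f ≫ r) ≫ ℓ) ≫ r) ≫ ℓ ⟶
      (SB.ext X).obj ((f ≫ r) ≫ ℓ) =>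
    ((α_ ((SB.ext X).obj f) r ℓ).inv ≫ inv (rEps adj SB X f) ▷ ℓ ≫
        t ≫ (SB.ext X).map (α_ f r ℓ).hom) ≫
        (SB.ext X).map (f ◁ adj.counit)) (colaxMate_rEps adj SB hν hinv X (f ≫ r)).symm

theorem isIso_epsW [IsIso adj.counit] {a : ℰ} (g : a ⟶ CB) : IsIso (epsW adj g) := by
  unfold epsW
  infer_instance

theorem transport_left_isPseudoMorphism
    (hε : ∀ (X : 𝒜) (f : J.obj X ⟶ CA), IsIso (epsW adj ((SB.ext X).obj (f ≫ ℓ)))) :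
    (⟨ℓ, fun X f => (inv (epsW adj ((SB.ext X).obj (f ≫ ℓ))) :
        (SB.ext X).obj (f ≫ ℓ) ⟶ ((SB.ext X).obj (f ≫ ℓ) ≫ r) ≫ ℓ)⟩ :
      LaxData (transportData adj SB hν hinv) SB).IsPseudoMorphism := by
  have h := transport_left_isColaxMorphism (adj := adj) (SB := SB) (hν := hν) (hinv := hinv)
  rw [colaxData_colaxMate_rEps] at h
  exact h.isPseudoMorphism_inv hε

theorem transport_unit_isTransformation
    (hε : ∀ (X : 𝒜) (f : J.obj X ⟶ CA), IsIso (epsW adj ((SB.ext X).obj (f ≫ ℓ)))) :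
    IsTransformation (idLaxData (transportData adj SB hν hinv))
      (compLaxData
        (⟨ℓ, fun X f => (inv (epsW adj ((SB.ext X).obj (f ≫ ℓ))) :
        (SB.ext X).obj (f ≫ ℓ) ⟶ ((SB.ext X).obj (f ≫ ℓ) ≫ r) ≫ ℓ)⟩ :
          LaxData (transportData adj SB hν hinv) SB)
        (⟨r, fun X f => rEps adj SB X f⟩ : LaxData SB (transportData adj SB hν hinv)))
      adj.unit := by
  intro X f
  change (SB.ext X).map ((f ◁ adj.unit) ▷ ℓ) ▷ r ≫
      (SB.ext X).map ((α_ f ℓ r).inv ▷ ℓ) ▷ r ≫ rEps adj SB X (f ≫ ℓ) ≫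
        inv (epsW adj ((SB.ext X).obj (f ≫ ℓ))) ▷ r ≫
        (α_ ((SB.ext X).obj (f ≫ ℓ) ≫ r) ℓ r).hom =
    ((SB.ext X).map ((ρ_ f).hom ▷ ℓ) ▷ r ≫ (ρ_ ((SB.ext X).obj (f ≫ ℓ) ≫ r)).inv) ≫
      ((SB.ext X).obj (f ≫ ℓ) ≫ r) ◁ adj.unit
  have h1 := nuW_map_rEps (adj := adj) (SB := SB) X f
  have h2 := nuW_epsW_whiskerRight adj ((SB.ext X).obj (f ≫ ℓ))
  rw [← cancel_epi ((SB.ext X).map ((ρ_ f).inv ▷ ℓ) ▷ r),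
    ← cancel_mono (α_ ((SB.ext X).obj (f ≫ ℓ) ≫ r) ℓ r).inv,
    ← cancel_mono (epsW adj ((SB.ext X).obj (f ≫ ℓ)) ▷ r)]
  simp only [nuW, Functor.map_comp, comp_whiskerRight, Category.assoc] at h1 h2
  simp only [Category.assoc, Iso.hom_inv_id_assoc, reassoc_of% h1, h2]
  simp [← comp_whiskerRight, ← Functor.map_comp]

theorem transport_counit_isTransformation
    (hε : ∀ (X : 𝒜) (f : J.obj X ⟶ CA), IsIso (epsW adj ((SB.ext X).obj (f ≫ ℓ)))) :
    IsTransformation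
      (compLaxData
        (⟨r, fun X f => rEps adj SB X f⟩ : LaxData SB (transportData adj SB hν hinv))
        (⟨ℓ, fun X f => (inv (epsW adj ((SB.ext X).obj (f ≫ ℓ))) :
        (SB.ext X).obj (f ≫ ℓ) ⟶ ((SB.ext X).obj (f ≫ ℓ) ≫ r) ≫ ℓ)⟩ :
          LaxData (transportData adj SB hν hinv) SB))
      (idLaxData SB) adj.counit := by
  intro X f
  change (SB.ext X).map (f ◁ adj.counit) ≫
      (SB.ext X).map (ρ_ f).hom ≫ (ρ_ ((SB.ext X).obj f)).inv =
    ((SB.ext X).map (α_ f r ℓ).inv ≫ inv (epsW adj ((SB.ext X).obj ((f ≫ r) ≫ ℓ))) ≫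
      rEps adj SB X f ▷ ℓ ≫ (α_ ((SB.ext X).obj f) r ℓ).hom) ≫
      (SB.ext X).obj f ◁ adj.counit
  have h1 := rEps_whiskerRight_epsW (adj := adj) (SB := SB) X f
  rw [← IsIso.inv_comp_eq] at h1
  rw [← cancel_mono (ρ_ ((SB.ext X).obj f)).hom,
    ← cancel_epi ((SB.ext X).map (α_ f r ℓ).hom)]
  simp only [epsW.eq_def adj ((SB.ext X).obj f), epsW.eq_def adj f, Functor.map_comp] at h1
  simp only [Category.assoc, Iso.inv_hom_id, Category.comp_id, ← h1]
  rw [← Functor.map_comp_assoc]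
  simp

/-- In an adjunction of colax morphisms the structure on the right adjoint is invertible,
with inverse the mate of the structure on the left adjoint. -/
theorem isIso_colax_of_isColaxTransformation {SA : T.AlgData CA}
    {lcℓ : ∀ (X : 𝒜) (f : J.obj X ⟶ CA),
      (SA.ext X).obj f ≫ ℓ ⟶ (SB.ext X).obj (f ≫ ℓ)}
    {lcr : ∀ (X : 𝒜) (g : J.obj X ⟶ CB),
      (SB.ext X).obj g ≫ r ⟶ (SA.ext X).obj (g ≫ r)}
    (hr : (⟨r, lcr⟩ : ColaxData SB SA).IsColaxMorphism)
    (hunit : IsColaxTransformation (idColaxData SA)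
      (compColaxData (⟨ℓ, lcℓ⟩ : ColaxData SA SB) (⟨r, lcr⟩ : ColaxData SB SA)) adj.unit)
    (hcounit : IsColaxTransformation
      (compColaxData (⟨r, lcr⟩ : ColaxData SB SA) (⟨ℓ, lcℓ⟩ : ColaxData SA SB))
      (idColaxData SB) adj.counit)
    (X : 𝒜) (g : J.obj X ⟶ CB) : IsIso (lcr X g) := by
  refine ⟨laxMate adj lcℓ X g, ?_, ?_⟩
  · have hc : (SB.ext X).obj g ◁ adj.counit ≫
        (ρ_ ((SB.ext X).obj g)).hom ≫ (SB.ext X).map (ρ_ g).inv =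
      ((α_ ((SB.ext X).obj g) r ℓ).inv ≫ lcr X g ▷ ℓ ≫
        lcℓ X (g ≫ r) ≫ (SB.ext X).map (α_ g r ℓ).hom) ≫
        (SB.ext X).map (g ◁ adj.counit) := hcounit X g
    have hc' : epsW adj ((SB.ext X).obj g) =
        lcr X g ▷ ℓ ≫ lcℓ X (g ≫ r) ≫ (SB.ext X).map (epsW adj g) := by
      rw [← cancel_epi (α_ ((SB.ext X).obj g) r ℓ).inv,
        ← cancel_mono ((SB.ext X).map (ρ_ g).inv)]
      simp only [epsW, Category.assoc, Iso.inv_hom_id_assoc, Functor.map_comp]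
      rw [hc]
      simp [← Functor.map_comp]
    have hm : laxMate adj lcℓ X g = nuW adj ((SA.ext X).obj (g ≫ r)) ≫
        lcℓ X (g ≫ r) ▷ r ≫ (SB.ext X).map (epsW adj g) ▷ r := by
      simp [laxMate, nuW]
    rw [hm, ← Category.assoc, nuW_natural, Category.assoc, ← comp_whiskerRight,
      ← comp_whiskerRight, ← hc', nuW_epsW_whiskerRight]
  · have hu : (SA.ext X).obj (g ≫ r) ◁ adj.unit ≫
        (α_ ((SA.ext X).obj (g ≫ r)) ℓ r).inv ≫ lcℓ X (g ≫ r) ▷ r ≫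
        lcr X ((g ≫ r) ≫ ℓ) ≫ (SA.ext X).map (α_ (g ≫ r) ℓ r).hom =
      ((ρ_ ((SA.ext X).obj (g ≫ r))).hom ≫ (SA.ext X).map (ρ_ (g ≫ r)).inv) ≫
        (SA.ext X).map ((g ≫ r) ◁ adj.unit) := hunit X (g ≫ r)
    have hn : lcr X ((g ≫ r) ≫ ℓ) ≫ (SA.ext X).map (epsW adj g ▷ r) =
      (SB.ext X).map (epsW adj g) ▷ r ≫ lcr X g := hr.natural (epsW adj g)
    have hu' : nuW adj ((SA.ext X).obj (g ≫ r)) ≫ lcℓ X (g ≫ r) ▷ r ≫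
        lcr X ((g ≫ r) ≫ ℓ) = (SA.ext X).map (nuW adj (g ≫ r)) := by
      rw [← cancel_epi (ρ_ ((SA.ext X).obj (g ≫ r))).hom,
        ← cancel_mono ((SA.ext X).map (α_ (g ≫ r) ℓ r).hom)]
      simp only [nuW, Category.assoc, Iso.hom_inv_id_assoc, hu, ← Functor.map_comp,
        Iso.inv_hom_id, Category.comp_id]
    have hm : laxMate adj lcℓ X g = nuW adj ((SA.ext X).obj (g ≫ r)) ≫
        lcℓ X (g ≫ r) ▷ r ≫ (SB.ext X).map (epsW adj g) ▷ r := by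
      simp [laxMate, nuW]
    rw [hm, Category.assoc, Category.assoc, ← hn, reassoc_of% hu', ← Functor.map_comp,
      nuW_epsW_whiskerRight, CategoryTheory.Functor.map_id]

theorem isIso_epsW_whiskerRight [IsIso adj.unit] {a : ℰ} (g : a ⟶ CB) :
    IsIso (epsW adj g ▷ r) := by
  have : IsIso (nuW adj (g ≫ r)) := by
    unfold nuW
    infer_instance
  rw [← IsIso.inv_eq_of_hom_inv_id (nuW_epsW_whiskerRight adj g)]
  infer_instance

end Transport

/-- transport of structure.  Let `(ν, ε) : ℓ ⊣ r` be a coreflective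
adjunction in `ℰ` (the unit `ν` is invertible) and let `(B, (-)^b, b̂, b̃)` be a
`T`-pseudoalgebra.  If `r (ε f)^b` is invertible for every `f : JX ⟶ B` then: (1) the
transported data is a `T`-pseudoalgebra structure on `A`; (2) `r`, with components
`r (ε f)^b`, is a pseudomorphism, and `ℓ`, with its mate structure, is a colax morphism;
(3) `ν` and `ε` are transformations, so the adjunction lifts to `PsAlg_c(T)`; and if
moreover `ℓ ⊣ r` is an adjoint equivalence it lifts to `PsAlg(T)`.  Conversely, if the
adjunction lifts to an adjunction in `PsAlg_c(T)` then every `r (ε f)^b` is invertible. -/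
theorem transport_of_structure
    (adj : Bicategory.Adjunction ℓ r) (SB : T.AlgData CB)
    (hν : IsIso adj.unit) (hB : SB.Laws) :
    (∀ hinv : ∀ (X : 𝒜) (f : J.obj X ⟶ CB), IsIso (rEps adj SB X f),
      -- (1) the transported data is a pseudoalgebra
      (transportData adj SB hν hinv).Laws ∧
      -- (2) `r` is a pseudomorphism and `ℓ` a colax morphism (its mate structure)
      (⟨r, fun X f => rEps adj SB X f⟩ :
          LaxData SB (transportData adj SB hν hinv)).IsPseudoMorphism ∧
      (⟨ℓ, colaxMate adj (fun X f => rEps adj SB X f)⟩ :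
          ColaxData (transportData adj SB hν hinv) SB).IsColaxMorphism ∧
      -- (3) the unit and counit are transformations, i.e. the adjunction lifts to
      -- `PsAlg_c(T)`
      IsColaxTransformation (idColaxData (transportData adj SB hν hinv))
        (compColaxData
          (⟨ℓ, colaxMate adj (fun X f => rEps adj SB X f)⟩ :
            ColaxData (transportData adj SB hν hinv) SB)
          (⟨r, fun X f => @inv _ _ _ _ (rEps adj SB X f) (hinv X f)⟩ :
            ColaxData SB (transportData adj SB hν hinv)))
        adj.unit ∧
      IsColaxTransformation
        (compColaxData
          (⟨r, fun X f => @inv _ _ _ _ (rEps adj SB X f) (hinv X f)⟩ :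
            ColaxData SB (transportData adj SB hν hinv))
          (⟨ℓ, colaxMate adj (fun X f => rEps adj SB X f)⟩ :
            ColaxData (transportData adj SB hν hinv) SB))
        (idColaxData SB) adj.counit ∧
      -- if `ℓ ⊣ r` is an adjoint equivalence, it lifts to an adjunction in `PsAlg(T)`
      (IsIso adj.counit →
        ∃ ll : ∀ (X : 𝒜) (f : J.obj X ⟶ CA),
            (SB.ext X).obj (f ≫ ℓ) ⟶
              ((transportData adj SB hν hinv).ext X).obj f ≫ ℓ,
          (⟨ℓ, ll⟩ : LaxData (transportData adj SB hν hinv) SB).IsPseudoMorphism ∧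
          IsTransformation (idLaxData (transportData adj SB hν hinv))
            (compLaxData
              (⟨ℓ, ll⟩ : LaxData (transportData adj SB hν hinv) SB)
              (⟨r, fun X f => rEps adj SB X f⟩ :
                LaxData SB (transportData adj SB hν hinv)))
            adj.unit ∧
          IsTransformation
            (compLaxData
              (⟨r, fun X f => rEps adj SB X f⟩ :
                LaxData SB (transportData adj SB hν hinv))
              (⟨ℓ, ll⟩ : LaxData (transportData adj SB hν hinv) SB))
            (idLaxData SB) adj.counit)) ∧
    -- converse: a lift to an adjunction in `PsAlg_c(T)` forces invertibility
    (∀ (SA : T.AlgData CA), SA.Laws →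
      ∀ (lcℓ : ∀ (X : 𝒜) (f : J.obj X ⟶ CA),
          (SA.ext X).obj f ≫ ℓ ⟶ (SB.ext X).obj (f ≫ ℓ))
        (lcr : ∀ (X : 𝒜) (g : J.obj X ⟶ CB),
          (SB.ext X).obj g ≫ r ⟶ (SA.ext X).obj (g ≫ r)),
        (⟨ℓ, lcℓ⟩ : ColaxData SA SB).IsColaxMorphism →
        (⟨r, lcr⟩ : ColaxData SB SA).IsColaxMorphism →
        IsColaxTransformation (idColaxData SA)
          (compColaxData (⟨ℓ, lcℓ⟩ : ColaxData SA SB) (⟨r, lcr⟩ : ColaxData SB SA))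
          adj.unit →
        IsColaxTransformation
          (compColaxData (⟨r, lcr⟩ : ColaxData SB SA) (⟨ℓ, lcℓ⟩ : ColaxData SA SB))
          (idColaxData SB) adj.counit →
        ∀ (X : 𝒜) (f : J.obj X ⟶ CB), IsIso (rEps adj SB X f)) := by
  refine ⟨fun hinv => ⟨transportData_laws hB, transport_right_isPseudoMorphism hB,
    transport_left_isColaxMorphism, transport_unit_isColaxTransformation,
    transport_counit_isColaxTransformation, fun hε => ?_⟩, ?_⟩
  · have hε' (X : 𝒜) (f : J.obj X ⟶ CA) : IsIso (epsW adj ((SB.ext X).obj (f ≫ ℓ))) :=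
      isIso_epsW _
    exact ⟨fun X f => (inv (epsW adj ((SB.ext X).obj (f ≫ ℓ))) :
        (SB.ext X).obj (f ≫ ℓ) ⟶ ((SB.ext X).obj (f ≫ ℓ) ≫ r) ≫ ℓ),
      transport_left_isPseudoMorphism hε', transport_unit_isTransformation hε',
      transport_counit_isTransformation hε'⟩
  · intro SA _ lcℓ lcr _ hr hunit hcounit X f
    have hiso := isIso_colax_of_isColaxTransformation hr hunit hcounit X
    have hn : lcr X ((f ≫ r) ≫ ℓ) ≫ (SA.ext X).map (epsW adj f ▷ r) =
      rEps adj SB X f ≫ lcr X f := hr.natural (epsW adj f)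
    have := isIso_epsW_whiskerRight (adj := adj) f
    rw [← IsIso.comp_inv_eq] at hn
    rw [← hn]
    infer_instance


end RelativePseudomonad
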